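/- Let R = S ×_k T be a non-trivial fiber product. For finitely generated R-modules M and N, the following conditions are equivalent: (i) Tor_i^R(M,N) = 0 for all sufficiently large i; (ii) Tor_i^R(M,N) = 0 for all i ≥ 2; (iii) Tor_i^R(M,N) = 0 = Tor_{i+1}^R(M,N) for some i ≥ 5; (iv) M has finite projective dimension over R or N has finite projective dimension over R; (v) M has projective dimension at most 1 over R or N has projective dimension at most 1 over R. -/

import Mathlib

open CategoryTheory Opposite IsLocalRing

noncomputable section

/-- Vanishing of `Tor_i^A(M, N)`. -/
abbrev TorZero (A : Type) [CommRing A] (M N : Type) [AddCommGroup M] [Module A M]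
    [AddCommGroup N] [Module A N] (i : ℕ) : Prop :=
  Subsingleton (((Tor (ModuleCat A) i).obj (ModuleCat.of A M)).obj (ModuleCat.of A N))

/-- Vanishing of `Ext^i_A(M, N)`. -/
abbrev ExtZero (A : Type) [CommRing A] (M N : Type) [AddCommGroup M] [Module A M]
    [AddCommGroup N] [Module A N] (i : ℕ) : Prop :=
  Subsingleton (((Ext A (ModuleCat A) i).obj (op (ModuleCat.of A M))).obj (ModuleCat.of A N))

/-- `M` has projective dimension at most `n` over `A`:
`Ext^i_A(M, -) = 0` for all `i > n`. -/
def PdLE (A : Type) [CommRing A] (M : Type) [AddCommGroup M] [Module A M] (n : ℕ) : Prop :=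
  ∀ (N : ModuleCat A) (i : ℕ), n < i →
    Subsingleton (((Ext A (ModuleCat A) i).obj (op (ModuleCat.of A M))).obj N)

/-- `N` has injective dimension at most `n` over `A`:
`Ext^i_A(-, N) = 0` for all `i > n`. -/
def IdLE (A : Type) [CommRing A] (N : Type) [AddCommGroup N] [Module A N] (n : ℕ) : Prop :=
  ∀ (X : ModuleCat A) (i : ℕ), n < i →
    Subsingleton (((Ext A (ModuleCat A) i).obj (op X)).obj (ModuleCat.of A N))

/-- The depth of a module over a noetherian local ring, as an extended natural number:
`inf { i | Ext^i_A(k, M) ≠ 0 }`. -/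
def depthM (A : Type) [CommRing A] [IsLocalRing A] (M : Type) [AddCommGroup M]
    [Module A M] : ℕ∞ :=
  sInf {n : ℕ∞ | ∃ i : ℕ, n = i ∧
    ¬ Subsingleton (((Ext A (ModuleCat A) i).obj
        (op (ModuleCat.of A (A ⧸ maximalIdeal A)))).obj (ModuleCat.of A M))}

/-- The fiber product `S ×ₖ T` as a subring of `S × T`. -/
def fiberProd {S T k : Type} [CommRing S] [CommRing T] [CommRing k]
    (πS : S →+* k) (πT : T →+* k) : Subring (S × T) :=
  RingHom.eqLocus (πS.comp (RingHom.fst S T)) (πT.comp (RingHom.snd S T))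

section DimensionShift

open Limits

universe v v' u u'
variable {C : Type u} [Category.{v} C] [Abelian C]
  {D : Type u'} [Category.{v'} D] [Abelian D]

/-- The augmentation of a projective resolution, with the resolved object as its codomain. -/
def resolutionAug {X : C} (Q : ProjectiveResolution X) : Q.complex.X 0 ⟶ X := Q.π.f 0

lemma d_comp_resolutionAug {X : C} (Q : ProjectiveResolution X) :
    Q.complex.d 1 0 ≫ resolutionAug Q = 0 := Q.complex_d_comp_π_f_zero

instance {X : C} (Q : ProjectiveResolution X) : Epi (resolutionAug Q) :=
  inferInstanceAs (Epi (Q.π.f 0))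

lemma resolutionAug_exact {X : C} (Q : ProjectiveResolution X) :
    (ShortComplex.mk _ _ (d_comp_resolutionAug Q)).Exact := Q.exact₀

lemma exact_comp_mono_iff {X₁ X₂ X₃ X₄ : C} (f : X₁ ⟶ X₂) (g : X₂ ⟶ X₃) (h : X₃ ⟶ X₄) [Mono h]
    (w : f ≫ g = 0) (w' : f ≫ g ≫ h = 0) :
    (ShortComplex.mk f g w).Exact ↔ (ShortComplex.mk f (g ≫ h) w').Exact := by
  let φ : ShortComplex.mk f g w ⟶ ShortComplex.mk f (g ≫ h) w' :=
    { τ₁ := 𝟙 _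
      τ₂ := 𝟙 _
      τ₃ := h }
  have : Epi φ.τ₁ := inferInstanceAs (Epi (𝟙 _))
  have : IsIso φ.τ₂ := inferInstanceAs (IsIso (𝟙 _))
  have : Mono φ.τ₃ := inferInstanceAs (Mono h)
  exact ShortComplex.exact_iff_of_epi_of_isIso_of_mono φ

lemma exact_epi_comp_iff {X₀ X₁ X₂ X₃ : C} (p : X₀ ⟶ X₁) (f : X₁ ⟶ X₂) (g : X₂ ⟶ X₃) [Epi p]
    (w : f ≫ g = 0) (w' : (p ≫ f) ≫ g = 0) :
    (ShortComplex.mk (p ≫ f) g w').Exact ↔ (ShortComplex.mk f g w).Exact := by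
  let φ : ShortComplex.mk (p ≫ f) g w' ⟶ ShortComplex.mk f g w :=
    { τ₁ := p
      τ₂ := 𝟙 _
      τ₃ := 𝟙 _ }
  have : Epi φ.τ₁ := inferInstanceAs (Epi p)
  have : IsIso φ.τ₂ := inferInstanceAs (IsIso (𝟙 _))
  have : Mono φ.τ₃ := inferInstanceAs (Mono (𝟙 _))
  exact ShortComplex.exact_iff_of_epi_of_isIso_of_mono φ

lemma d_comp_resolutionAug_comp {X Y : C} (Q : ProjectiveResolution X) (f : X ⟶ Y) :
    Q.complex.d 1 0 ≫ resolutionAug Q ≫ f = 0 := by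
  rw [← Category.assoc, d_comp_resolutionAug, zero_comp]

lemma resolutionAug_comp_comp {S : ShortComplex C} (Q : ProjectiveResolution S.X₁) :
    (resolutionAug Q ≫ S.f) ≫ S.g = 0 := by
  rw [Category.assoc, S.zero, comp_zero]

/-- Splicing a projective resolution of the kernel of an epimorphism from a projective object. -/
def spliceResolution {S : ShortComplex C} (hS : S.ShortExact) [Projective S.X₂]
    (Q : ProjectiveResolution S.X₁) : ProjectiveResolution S.X₃ where
  complex := Q.complex.augment (resolutionAug Q ≫ S.f) (d_comp_resolutionAug_comp Q S.f)
  projective n := by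
    cases n with
    | zero => exact (inferInstance : Projective S.X₂)
    | succ n => exact Q.projective n
  π := (ChainComplex.toSingle₀Equiv _ _).symm ⟨S.g, resolutionAug_comp_comp Q⟩
  quasiIso := by
    have := hS.mono_f
    have := hS.epi_g
    refine ⟨fun n => ?_⟩
    cases n with
    | zero =>
      rw [ChainComplex.quasiIsoAt₀_iff, ShortComplex.quasiIso_iff_of_zeros' _ rfl rfl rfl]
      refine (ShortComplex.exact_and_epi_g_iff_of_iso
        (S₂ := ShortComplex.mk _ _ (resolutionAug_comp_comp Q)) ?_).2
        ⟨(exact_epi_comp_iff _ _ _ S.zero _).2 hS.exact, by dsimp; infer_instance⟩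
      refine ShortComplex.isoMk (Iso.refl _) (Iso.refl _) (Iso.refl _) ?_ ?_
      · exact (Category.id_comp (resolutionAug Q ≫ S.f)).trans
          (Category.comp_id (resolutionAug Q ≫ S.f)).symm
      · refine (Category.id_comp S.g).trans (Eq.trans ?_ (Category.comp_id _).symm)
        exact (ChainComplex.toSingle₀Equiv_symm_apply_f_zero
          (C := Q.complex.augment _ (d_comp_resolutionAug_comp Q S.f)) S.g
          (resolutionAug_comp_comp Q)).symm
    | succ n =>
      rw [quasiIsoAt_iff_exactAt' _ _ (ChainComplex.exactAt_succ_single_obj _ _),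
        HomologicalComplex.exactAt_iff' _ (n + 2) (n + 1) n (by simp) (by simp)]
      cases n with
      | succ n => exact Q.exact_succ n
      | zero => exact (exact_comp_mono_iff _ _ S.f (d_comp_resolutionAug Q)
          (d_comp_resolutionAug_comp Q S.f)).1 (resolutionAug_exact Q)

variable [EnoughProjectives C] (F : C ⥤ D) [F.Additive]

lemma isZero_leftDerived_succ_iff_exact {X : C} (P : ProjectiveResolution X) (n : ℕ) :
    IsZero ((F.leftDerived (n + 1)).obj X) ↔
      (ShortComplex.mk (F.map (P.complex.d (n + 2) (n + 1))) (F.map (P.complex.d (n + 1) n))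
        (by rw [← F.map_comp, P.complex.d_comp_d, F.map_zero])).Exact := by
  rw [(P.isoLeftDerivedObj F (n + 1)).isZero_iff]
  erw [← HomologicalComplex.exactAt_iff_isZero_homology]
  rw [HomologicalComplex.exactAt_iff' _ (n + 2) (n + 1) n (by simp) (by simp)]
  rfl

lemma isZero_leftDerived_succ_succ_iff {S : ShortComplex C} (hS : S.ShortExact)
    [Projective S.X₂] (n : ℕ) :
    IsZero ((F.leftDerived (n + 2)).obj S.X₃) ↔ IsZero ((F.leftDerived (n + 1)).obj S.X₁) := by
  rw [isZero_leftDerived_succ_iff_exact F (spliceResolution hS (projectiveResolution S.X₁)),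
    isZero_leftDerived_succ_iff_exact F (projectiveResolution S.X₁)]
  rfl

lemma isZero_leftDerived_one_iff [PreservesFiniteColimits F] {S : ShortComplex C}
    (hS : S.ShortExact) [Projective S.X₂] :
    IsZero ((F.leftDerived 1).obj S.X₃) ↔ Mono (F.map S.f) := by
  let Q := projectiveResolution S.X₁
  have w : F.map (Q.complex.d 1 0) ≫ F.map (resolutionAug Q) = 0 := by
    rw [← F.map_comp, d_comp_resolutionAug, F.map_zero]
  have hF : (ShortComplex.mk _ _ w).Exact := by
    refine ((ShortComplex.exact_and_epi_g_iff_g_is_cokernel _).2 ⟨?_⟩).1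
    exact CokernelCofork.mapIsColimit _ Q.isColimitCokernelCofork F
  have w' : F.map (Q.complex.d 1 0) ≫ F.map (resolutionAug Q) ≫ F.map S.f = 0 := by
    rw [← Category.assoc, w, zero_comp]
  have key : IsZero ((F.leftDerived 1).obj S.X₃) ↔ (ShortComplex.mk _ _ w').Exact := by
    rw [isZero_leftDerived_succ_iff_exact F (spliceResolution hS Q)]
    simp only [← F.map_comp]
    rfl
  rw [key]
  constructor
  · intro h
    refine (Preadditive.mono_iff_cancel_zero _).2 fun A a ha => ?_
    obtain ⟨A', p, hp, x, hx⟩ := surjective_up_to_refinements_of_epi (F.map (resolutionAug Q)) a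
    obtain ⟨A'', q, hq, y, hy⟩ := h.exact_up_to_refinements x (by
      change x ≫ F.map (resolutionAug Q) ≫ F.map S.f = 0
      rw [← Category.assoc, ← hx, Category.assoc, ha, comp_zero])
    change q ≫ x = y ≫ F.map (Q.complex.d 1 0) at hy
    rw [← cancel_epi p, ← cancel_epi q, hx, ← Category.assoc, hy, Category.assoc, w]
    simp
  · intro h
    exact (exact_comp_mono_iff _ _ _ w w').1 hF

end DimensionShift

section Modules

open Limits Function

variable {A : Type} [CommRing A]
  {X Y Z F G : Type} [AddCommGroup X] [Module A X] [AddCommGroup Y] [Module A Y]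
  [AddCommGroup Z] [Module A Z]
  [AddCommGroup F] [Module A F] [AddCommGroup G] [Module A G]

lemma torZero_iff_isZero (i : ℕ) : TorZero A X Y i ↔
    IsZero ((((MonoidalCategory.tensoringLeft (ModuleCat A)).obj
      (ModuleCat.of A X)).leftDerived i).obj (ModuleCat.of A Y)) :=
  (ModuleCat.isZero_iff_subsingleton).symm

lemma extZero_iff_isZero (i : ℕ) : ExtZero A X Z i ↔
    IsZero ((((linearYoneda A (ModuleCat A)).obj (ModuleCat.of A Z)).rightOp.leftDerived i).obj
      (ModuleCat.of A X)) :=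
  (ModuleCat.isZero_iff_subsingleton).symm.trans
    ⟨fun h => h.op, fun h => h.unop⟩

/-- The short complex `ker f → F → Y`. -/
def kerShortComplex (f : F →ₗ[A] Y) : ShortComplex (ModuleCat A) :=
  ShortComplex.mk (ModuleCat.ofHom (LinearMap.ker f).subtype) (ModuleCat.ofHom f) (by
    ext x; exact x.2)

lemma kerShortComplex_shortExact {f : F →ₗ[A] Y} (hf : Surjective f) :
    (kerShortComplex f).ShortExact where
  exact := (ShortComplex.ShortExact.moduleCat_exact_iff_function_exact _).2
    (LinearMap.exact_subtype_ker_map f)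
  mono_f := (ModuleCat.mono_iff_injective _).2 (Subtype.val_injective)
  epi_g := (ModuleCat.epi_iff_surjective _).2 hf

instance [Module.Projective A F] (f : F →ₗ[A] Y) : Projective (kerShortComplex f).X₂ :=
  (IsProjective.iff_projective F).1 inferInstance

lemma torZero_succ_succ_iff [Module.Projective A F] {f : F →ₗ[A] Y} (hf : Surjective f) (i : ℕ) :
    TorZero A X Y (i + 2) ↔ TorZero A X (LinearMap.ker f) (i + 1) := by
  rw [torZero_iff_isZero, torZero_iff_isZero]
  exact isZero_leftDerived_succ_succ_iff _ (kerShortComplex_shortExact hf) i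

lemma extZero_succ_succ_iff [Module.Projective A F] {f : F →ₗ[A] Y} (hf : Surjective f) (i : ℕ) :
    ExtZero A Y Z (i + 2) ↔ ExtZero A (LinearMap.ker f) Z (i + 1) := by
  rw [extZero_iff_isZero, extZero_iff_isZero]
  exact isZero_leftDerived_succ_succ_iff _ (kerShortComplex_shortExact hf) i

lemma torZero_one_iff [Module.Projective A F] {f : F →ₗ[A] Y} (hf : Surjective f) :
    TorZero A X Y 1 ↔ Injective ((LinearMap.ker f).subtype.lTensor X) := by
  rw [torZero_iff_isZero]
  have : PreservesFiniteColimits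
      ((MonoidalCategory.tensoringLeft (ModuleCat A)).obj (ModuleCat.of A X)) :=
    inferInstanceAs (PreservesFiniteColimits (MonoidalCategory.tensorLeft (ModuleCat.of A X)))
  refine (isZero_leftDerived_one_iff _ (kerShortComplex_shortExact hf)).trans ?_
  exact ModuleCat.mono_iff_injective _

lemma exists_extension_of_extZero_one [Module.Projective A F] {f : F →ₗ[A] Y} (hf : Surjective f)
    (h : ExtZero A Y Z 1) (g : LinearMap.ker f →ₗ[A] Z) :
    ∃ g' : F →ₗ[A] Z, g' ∘ₗ (LinearMap.ker f).subtype = g := by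
  rw [extZero_iff_isZero] at h
  have : PreservesFiniteLimits
      ((linearYoneda A (ModuleCat A)).obj (ModuleCat.of A Z) ⋙ forget _) :=
    inferInstanceAs (PreservesFiniteLimits (yoneda.obj (ModuleCat.of A Z)))
  have : PreservesFiniteLimits ((linearYoneda A (ModuleCat A)).obj (ModuleCat.of A Z)) :=
    preservesFiniteLimits_of_reflects_of_preserves _ (forget _)
  have : PreservesFiniteColimits
      ((linearYoneda A (ModuleCat A)).obj (ModuleCat.of A Z)).rightOp :=
    preservesFiniteColimits_rightOp _
  have := (isZero_leftDerived_one_iff _ (kerShortComplex_shortExact hf)).1 h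
  have h2 : Epi (((linearYoneda A (ModuleCat A)).obj (ModuleCat.of A Z)).map
      (kerShortComplex f).f.op) := by
    have h3 := unop_epi_of_mono (((linearYoneda A (ModuleCat A)).obj
      (ModuleCat.of A Z)).rightOp.map (kerShortComplex f).f)
    exact h3
  obtain ⟨g', hg'⟩ := (ModuleCat.epi_iff_surjective _).1 h2 (ModuleCat.ofHom g)
  exact ⟨ModuleCat.Hom.hom g', congrArg ModuleCat.Hom.hom hg'⟩

lemma torZero_succ_of_projective_right [Module.Projective A Y] (i : ℕ) :
    TorZero A X Y (i + 1) := by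
  have : Projective (ModuleCat.of A Y) := (IsProjective.iff_projective Y).1 inferInstance
  exact ModuleCat.isZero_iff_subsingleton.1 (isZero_Tor_succ_of_projective _ _ _ i)

lemma extZero_succ_of_projective [Module.Projective A Y] (i : ℕ) :
    ExtZero A Y Z (i + 1) := by
  have : Projective (ModuleCat.of A Y) := (IsProjective.iff_projective Y).1 inferInstance
  exact ModuleCat.isZero_iff_subsingleton.1 (isZero_Ext_succ_of_projective _ _ i)

lemma isZero_of_retract {C : Type*} [Category C] [HasZeroMorphisms C] {U V : C} (s : U ⟶ V)
    (r : V ⟶ U) (h : s ≫ r = 𝟙 U) (hV : IsZero V) : IsZero U := by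
  rw [IsZero.iff_id_eq_zero, ← h, hV.eq_of_tgt s 0, zero_comp]

lemma TorZero.retract_left {s : X →ₗ[A] Z} {r : Z →ₗ[A] X} (h : r ∘ₗ s = LinearMap.id) {i : ℕ}
    (hZ : TorZero A Z Y i) : TorZero A X Y i := by
  refine ModuleCat.isZero_iff_subsingleton.1 (isZero_of_retract
    (((Tor (ModuleCat A) i).map (ModuleCat.ofHom s)).app _)
    (((Tor (ModuleCat A) i).map (ModuleCat.ofHom r)).app _) ?_
    (ModuleCat.isZero_iff_subsingleton.2 hZ))
  rw [← NatTrans.comp_app, ← Functor.map_comp, ← ModuleCat.ofHom_comp, h]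
  exact NatTrans.congr_app ((Tor (ModuleCat A) i).map_id (ModuleCat.of A X)) (ModuleCat.of A Y)

lemma TorZero.retract_right {s : X →ₗ[A] Z} {r : Z →ₗ[A] X} (h : r ∘ₗ s = LinearMap.id) {i : ℕ}
    (hZ : TorZero A Y Z i) : TorZero A Y X i := by
  refine ModuleCat.isZero_iff_subsingleton.1 (isZero_of_retract
    (((Tor (ModuleCat A) i).obj _).map (ModuleCat.ofHom s))
    (((Tor (ModuleCat A) i).obj _).map (ModuleCat.ofHom r)) ?_
    (ModuleCat.isZero_iff_subsingleton.2 hZ))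
  rw [← Functor.map_comp, ← ModuleCat.ofHom_comp, h]
  exact CategoryTheory.Functor.map_id _ _

lemma exists_free_surjective (Y : Type) [AddCommGroup Y] [Module A Y] :
    ∃ f : (Y →₀ A) →ₗ[A] Y, Surjective f :=
  ⟨Finsupp.linearCombination A id, Finsupp.linearCombination_id_surjective A Y⟩

lemma lTensor_injective_iff_rTensor_injective {K L : Type} [AddCommGroup K] [Module A K]
    [AddCommGroup L] [Module A L] {ι : K →ₗ[A] F} {f : F →ₗ[A] Y} {κ : L →ₗ[A] G} {g : G →ₗ[A] X}
    [Module.Flat A F] [Module.Flat A G]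
    (hι : Injective ι) (hκ : Injective κ) (hιf : Exact ι f) (hκg : Exact κ g)
    (hf : Surjective f) (hg : Surjective g) :
    Injective (ι.lTensor X) ↔ Injective (κ.rTensor Y) := by
  rw [← LinearMap.lTensor_inj_iff_rTensor_inj]
  constructor
  · intro h
    refine lTensor_injective_of_exact_of_exact_of_rTensor_injective hιf hf hκg hg ?_
      (Module.Flat.lTensor_preserves_injective_linearMap κ hκ)
    rwa [← LinearMap.lTensor_inj_iff_rTensor_inj]
  · intro h
    refine lTensor_injective_of_exact_of_exact_of_rTensor_injective hκg hg hιf hf ?_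
      (Module.Flat.lTensor_preserves_injective_linearMap ι hι)
    rwa [← LinearMap.lTensor_inj_iff_rTensor_inj]

lemma torZero_one_iff' [Module.Projective A G] {g : G →ₗ[A] X} (hg : Surjective g) :
    TorZero A X Y 1 ↔ Injective ((LinearMap.ker g).subtype.rTensor Y) := by
  obtain ⟨f, hf⟩ := exists_free_surjective (A := A) Y
  rw [torZero_one_iff hf]
  exact lTensor_injective_iff_rTensor_injective (K := LinearMap.ker f) (L := LinearMap.ker g)
    Subtype.val_injective Subtype.val_injective
    (LinearMap.exact_subtype_ker_map f) (LinearMap.exact_subtype_ker_map g) hf hg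

lemma torZero_succ_succ_iff' [Module.Projective A G] {g : G →ₗ[A] X} (hg : Surjective g) (i : ℕ) :
    TorZero A X Y (i + 2) ↔ TorZero A (LinearMap.ker g) Y (i + 1) := by
  induction i generalizing Y with
  | zero =>
    obtain ⟨f, hf⟩ := exists_free_surjective (A := A) Y
    rw [torZero_succ_succ_iff hf, torZero_one_iff' hg, torZero_one_iff hf]
    have h₁ : Injective ((LinearMap.ker f).subtype.lTensor G) :=
      Module.Flat.lTensor_preserves_injective_linearMap _ Subtype.val_injective
    have h₂ : Injective ((LinearMap.ker g).subtype.rTensor (Y →₀ A)) :=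
      Module.Flat.rTensor_preserves_injective_linearMap _ Subtype.val_injective
    rw [← h₁.of_comp_iff, ← h₂.of_comp_iff, ← LinearMap.coe_comp, ← LinearMap.coe_comp,
      LinearMap.lTensor_comp_rTensor, LinearMap.rTensor_comp_lTensor]
  | succ i ih =>
    obtain ⟨f, hf⟩ := exists_free_surjective (A := A) Y
    rw [torZero_succ_succ_iff hf, ih, torZero_succ_succ_iff hf]

lemma torZero_succ_of_projective_left [Module.Projective A X] (i : ℕ) :
    TorZero A X Y (i + 1) := by
  induction i generalizing Y with
  | zero =>
    obtain ⟨f, hf⟩ := exists_free_surjective (A := A) Y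
    rw [torZero_one_iff hf]
    exact Module.Flat.lTensor_preserves_injective_linearMap _ Subtype.val_injective
  | succ i ih =>
    obtain ⟨f, hf⟩ := exists_free_surjective (A := A) Y
    rw [torZero_succ_succ_iff hf]
    exact ih

lemma projective_of_extZero_one (h : ∀ (Z : Type) [AddCommGroup Z] [Module A Z], ExtZero A Y Z 1) :
    Module.Projective A Y := by
  obtain ⟨f, hf⟩ := exists_free_surjective (A := A) Y
  obtain ⟨r, hr⟩ := exists_extension_of_extZero_one hf (h (LinearMap.ker f)) LinearMap.id
  have hs : ∃ s, f ∘ₗ s = LinearMap.id :=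
    (((Exact.split_tfae' (M := LinearMap.ker f)
      (LinearMap.exact_subtype_ker_map f)).out 1 0 rfl rfl).1 ⟨hf, r, hr⟩).2
  exact Module.Projective.of_split hs.choose f hs.choose_spec

lemma PdLE.torZero {n : ℕ} (h : PdLE A Y n) (X : Type) [AddCommGroup X] [Module A X] (i : ℕ)
    (hi : n < i) : TorZero A X Y i ∧ TorZero A Y X i := by
  induction n generalizing Y i with
  | zero =>
    obtain ⟨i, rfl⟩ : ∃ j, i = j + 1 := ⟨i - 1, by omega⟩
    have : Module.Projective A Y :=
      projective_of_extZero_one fun Z _ _ => h (ModuleCat.of A Z) 1 one_pos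
    exact ⟨torZero_succ_of_projective_right i, torZero_succ_of_projective_left i⟩
  | succ n ih =>
    obtain ⟨i, rfl⟩ : ∃ j, i = j + 2 := ⟨i - 2, by omega⟩
    obtain ⟨f, hf⟩ := exists_free_surjective (A := A) Y
    rw [torZero_succ_succ_iff hf, torZero_succ_succ_iff' hf]
    refine ih (fun Z j hj => ?_) _ (by omega)
    obtain ⟨j, rfl⟩ : ∃ l, j = l + 1 := ⟨j - 1, by omega⟩
    exact (extZero_succ_succ_iff (Z := Z) hf j).1 (h Z (j + 2) (by omega))

lemma pdLE_one_of_projective_ker [Module.Projective A F] {f : F →ₗ[A] Y} (hf : Surjective f)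
    [Module.Projective A (LinearMap.ker f)] : PdLE A Y 1 := by
  intro Z i hi
  obtain ⟨i, rfl⟩ : ∃ j, i = j + 2 := ⟨i - 2, by omega⟩
  exact (extZero_succ_succ_iff (Z := Z) hf i).2 (extZero_succ_of_projective i)

lemma pdLE_one_of_ker_eq_bot [Module.Projective A F] [Module.Projective A G] {f : F →ₗ[A] Y}
    (hf : Surjective f) {g : G →ₗ[A] LinearMap.ker f} (hg : Surjective g)
    (hk : LinearMap.ker g = ⊥) : PdLE A Y 1 := by
  have : Module.Projective A (LinearMap.ker f) :=
    Module.Projective.of_equiv (LinearEquiv.ofBijective g ⟨LinearMap.ker_eq_bot.1 hk, hg⟩)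
  exact pdLE_one_of_projective_ker hf

end Modules

section LocalRing

open Function TensorProduct

variable {R : Type} [CommRing R] [IsLocalRing R]

lemma exists_minimal_cover (X : Type) [AddCommGroup X] [Module R X] [Module.Finite R X] :
    ∃ (n : ℕ) (f : (Fin n → R) →ₗ[R] X), Surjective f ∧
      ∀ x ∈ LinearMap.ker f, ∀ i, x i ∈ maximalIdeal R := by
  let b := Module.finBasis (ResidueField R) (ResidueField R ⊗[R] X)
  choose v hv using fun i => TensorProduct.mk_surjective R X (ResidueField R)
    residue_surjective (b i)
  refine ⟨_, Fintype.linearCombination R v, ?_, fun x hx i => ?_⟩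
  · rw [← LinearMap.range_eq_top, Fintype.range_linearCombination]
    exact span_eq_top_of_tmul_eq_basis v b hv
  · have h : ∑ i, residue R (x i) • b i = 0 := by
      rw [LinearMap.mem_ker, Fintype.linearCombination_apply] at hx
      simpa [← hv, TensorProduct.tmul_sum, Algebra.smul_def, TensorProduct.smul_tmul'] using
        congrArg (TensorProduct.mk R (ResidueField R) X 1) hx
    have := Fintype.linearIndependent_iff.1 b.linearIndependent _ h i
    rwa [residue_eq_zero_iff] at this

lemma nontrivial_tensorProduct (X Y : Type) [AddCommGroup X] [Module R X] [Module.Finite R X]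
    [AddCommGroup Y] [Module R Y] [Module.Finite R Y] [Nontrivial X] [Nontrivial Y] :
    Nontrivial (X ⊗[R] Y) := by
  have (Z : Type) [AddCommGroup Z] [Module R Z] [Module.Finite R Z] :
      Nontrivial (ResidueField R ⊗[R] Z) ↔ Nontrivial Z := by
    rw [← not_subsingleton_iff_nontrivial, ← not_subsingleton_iff_nontrivial,
      subsingleton_tensorProduct]
  have hX := (this X).2 inferInstance
  have hY := (this Y).2 inferInstance
  rw [← this, (AlgebraTensorModule.distribBaseChange R (ResidueField R) X Y).nontrivial_congr]
  infer_instance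

end LocalRing

section Decomposition

open Function

/-- The maximal ideal of `R` is the direct sum of the nonzero ideals `I` and `J`. -/
structure DecomposesMaximalIdeal {R : Type} [CommRing R] [IsLocalRing R] (I J : Ideal R) :
    Prop where
  disjoint : Disjoint I J
  sup_eq : I ⊔ J = maximalIdeal R
  ne_bot_left : I ≠ ⊥
  ne_bot_right : J ≠ ⊥

namespace DecomposesMaximalIdeal

variable {R : Type} [CommRing R] [IsLocalRing R] {I J : Ideal R}

lemma symm (h : DecomposesMaximalIdeal I J) : DecomposesMaximalIdeal J I :=
  ⟨h.disjoint.symm, sup_comm J I ▸ h.sup_eq, h.ne_bot_right, h.ne_bot_left⟩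

lemma mul_eq_zero (h : DecomposesMaximalIdeal I J) {a b : R} (ha : a ∈ I) (hb : b ∈ J) :
    a * b = 0 :=
  Submodule.disjoint_def.1 h.disjoint _ (I.mul_mem_right b ha) (J.mul_mem_left a hb)

end DecomposesMaximalIdeal

lemma exists_retraction {R F : Type} [CommRing R] [AddCommGroup F] [Module R F]
    {K U V : Submodule R F} (hd : Disjoint U V) (h : U ⊔ V = K) :
    ∃ (hU : U ≤ K) (r : K →ₗ[R] U), r ∘ₗ Submodule.inclusion hU = LinearMap.id := by
  have hU : U ≤ K := h ▸ le_sup_left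
  have hV : V ≤ K := h ▸ le_sup_right
  have hc : IsCompl (U.comap K.subtype) (V.comap K.subtype) := by
    constructor
    · rw [Submodule.disjoint_def] at hd ⊢
      exact fun x hx hx' => Subtype.ext (hd _ hx hx')
    · rw [codisjoint_iff, eq_top_iff]
      rintro ⟨x, hx⟩ -
      obtain ⟨u, hu, v, hv, rfl⟩ := Submodule.mem_sup.1 (h ▸ hx : x ∈ U ⊔ V)
      exact Submodule.mem_sup.2 ⟨⟨u, hU hu⟩, hu, ⟨v, hV hv⟩, hv, rfl⟩
  refine ⟨hU, (Submodule.comapSubtypeEquivOfLe hU).toLinearMap ∘ₗ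
    Submodule.projectionOnto _ _ hc, ?_⟩
  ext x
  have : Submodule.inclusion hU x =
    ((Submodule.comapSubtypeEquivOfLe hU).symm x : U.comap K.subtype) := rfl
  rw [LinearMap.comp_apply, this, LinearMap.comp_apply, Submodule.projectionOnto_apply_left]
  simp

variable {R : Type} [CommRing R] [IsLocalRing R] {I J : Ideal R}

lemma exists_cover_retraction (h : DecomposesMaximalIdeal I J)
    (X : Type) [AddCommGroup X] [Module R X] [Module.Finite R X] [Nontrivial X]
    (hX : ∀ t ∈ J, ∀ x : X, t • x = 0) :
    ∃ (n : ℕ) (f : (Fin n → R) →ₗ[R] X) (s : J →ₗ[R] LinearMap.ker f)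
      (r : LinearMap.ker f →ₗ[R] J), Surjective f ∧ r ∘ₗ s = LinearMap.id ∧
        ∀ t i, (s t : Fin n → R) i ∈ J := by
  obtain ⟨n, f, hf, hk⟩ := exists_minimal_cover (R := R) X
  obtain ⟨hJ, r, hr⟩ := exists_retraction h.symm.disjoint h.symm.sup_eq
  have i₀ : Fin n := by
    cases n with
    | zero => exact (not_subsingleton X hf.subsingleton).elim
    | succ n => exact 0
  refine ⟨n, f, (LinearMap.single R (fun _ => R) i₀ ∘ₗ J.subtype).codRestrict _ fun t => ?_,
    r ∘ₗ (LinearMap.proj i₀ ∘ₗ (LinearMap.ker f).subtype).codRestrict (maximalIdeal R)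
      fun x => hk x x.2 i₀, hf, ?_, fun t i => ?_⟩
  · have : (Pi.single i₀ (t : R) : Fin n → R) = (t : R) • Pi.single i₀ 1 := by
      rw [← Pi.single_smul, smul_eq_mul, mul_one]
    change f (Pi.single i₀ (t : R)) = 0
    rw [this, map_smul, hX t t.2]
  · refine LinearMap.ext fun t => Eq.trans (congrArg r (Subtype.ext ?_)) (LinearMap.congr_fun hr t)
    exact Pi.single_eq_same (M := fun _ => R) i₀ (t : R)
  · change (Pi.single i₀ (t : R) : Fin n → R) i ∈ J
    by_cases hi : i = i₀
    · subst hi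
      simp
    · simp [hi]

variable [IsNoetherianRing R]

lemma subsingleton_of_torZero_one (h : DecomposesMaximalIdeal I J) {n : ℕ}
    {Y : Type} [AddCommGroup Y] [Module R Y] {f : (Fin n → R) →ₗ[R] Y} (hf : Surjective f)
    {B : Type} [AddCommGroup B] [Module R B] [Module.Finite R B]
    {s : B →ₗ[R] LinearMap.ker f} {r : LinearMap.ker f →ₗ[R] B} (hrs : r ∘ₗ s = LinearMap.id)
    (hs : ∀ b i, (s b : Fin n → R) i ∈ J) (ht : TorZero R I Y 1) : Subsingleton B := by
  rw [torZero_one_iff hf] at ht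
  by_contra hB
  rw [not_subsingleton_iff_nontrivial] at hB
  have : Nontrivial I := Submodule.nontrivial_iff_ne_bot.2 h.ne_bot_left
  refine not_subsingleton_iff_nontrivial.2 (nontrivial_tensorProduct (R := R) I B) ?_
  have hs' : Injective (s.lTensor I) := by
    refine LeftInverse.injective (g := r.lTensor I) fun z => ?_
    rw [← LinearMap.comp_apply, ← LinearMap.lTensor_comp, hrs, LinearMap.lTensor_id,
      LinearMap.id_apply]
  have hz : (LinearMap.ker f).subtype.lTensor I ∘ₗ s.lTensor I = 0 := by
    refine TensorProduct.ext' fun a b => ?_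
    have hb : (s b : Fin n → R) = ∑ i, (s b : Fin n → R) i • Pi.single i (1 : R) :=
      pi_eq_sum_univ' _
    simp only [LinearMap.comp_apply, LinearMap.lTensor_tmul, Submodule.subtype_apply,
      LinearMap.zero_apply]
    rw [hb, TensorProduct.tmul_sum]
    refine Finset.sum_eq_zero fun i _ => ?_
    have ha : (s b : Fin n → R) i • a = 0 :=
      Subtype.ext ((mul_comm _ _).trans (h.mul_eq_zero a.2 (hs b i)))
    rw [← TensorProduct.smul_tmul, ha, TensorProduct.zero_tmul]
  exact ⟨fun x y => (ht.comp hs')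
    ((LinearMap.congr_fun hz x).trans (LinearMap.congr_fun hz y).symm)⟩

lemma not_torZero_of_smul_eq_zero (h : DecomposesMaximalIdeal I J)
    (X : Type) [AddCommGroup X] [Module R X] [Module.Finite R X] [Nontrivial X]
    (hX : ∀ t ∈ J, ∀ x : X, t • x = 0) (l : ℕ) :
    ¬ (TorZero R I X (l + 1) ∧ TorZero R J X (l + 1)) := by
  rintro ⟨hI, hJ⟩
  obtain ⟨n, f, s, r, hf, hrs, hs⟩ := exists_cover_retraction h X hX
  have hnJ : Nontrivial J := Submodule.nontrivial_iff_ne_bot.2 h.ne_bot_right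
  induction l generalizing I J X n with
  | zero =>
    exact not_subsingleton_iff_nontrivial.2 hnJ (subsingleton_of_torZero_one h hf hrs hs hI)
  | succ l ih =>
    rw [torZero_succ_succ_iff hf] at hI hJ
    have hJI : ∀ t ∈ I, ∀ x : J, t • x = 0 :=
      fun t ht x => Subtype.ext (h.mul_eq_zero ht x.2)
    obtain ⟨n', f', s', r', hf', hrs', hs'⟩ := exists_cover_retraction h.symm J hJI
    exact ih h.symm J hJI (hJ.retract_right hrs) (hI.retract_right hrs) n' f' s' r' hf' hrs' hs'
      (Submodule.nontrivial_iff_ne_bot.2 h.ne_bot_left)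

/-- Two consecutive covers whose second syzygy is the direct sum of its intersections with the
multiples of `I` and of `J`. -/
lemma exists_secondSyzygy (h : DecomposesMaximalIdeal I J)
    (X : Type) [AddCommGroup X] [Module R X] [Module.Finite R X] :
    ∃ (n : ℕ) (f : (Fin n → R) →ₗ[R] X) (n' : ℕ) (g : (Fin n' → R) →ₗ[R] LinearMap.ker f)
      (U V : Submodule R (Fin n' → R)), Surjective f ∧ Surjective g ∧ Disjoint U V ∧
        U ⊔ V = LinearMap.ker g ∧ (∀ x ∈ U, ∀ i, x i ∈ I) ∧ (∀ x ∈ V, ∀ i, x i ∈ J) := by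
  obtain ⟨n, f, hf, -⟩ := exists_minimal_cover (R := R) X
  obtain ⟨n', g, hg, hk⟩ := exists_minimal_cover (R := R) (LinearMap.ker f)
  let c (L : Ideal R) : Submodule R (Fin n' → R) := Submodule.pi Set.univ fun _ => L
  have hc {L : Ideal R} {x : Fin n' → R} : x ∈ c L ↔ ∀ i, x i ∈ L := by
    simp [c, Submodule.mem_pi]
  have hgc {L : Ideal R} {x : Fin n' → R} (hx : x ∈ c L) (i : Fin n) :
      (g x : Fin n → R) i ∈ L := by
    rw [pi_eq_sum_univ' x, map_sum, AddSubmonoidClass.coe_finsetSum, Finset.sum_apply]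
    refine L.sum_mem fun j _ => ?_
    rw [map_smul]
    exact L.mul_mem_right _ (hc.1 hx j)
  refine ⟨n, f, n', g, LinearMap.ker g ⊓ c I, LinearMap.ker g ⊓ c J, hf, hg, ?_, ?_,
    fun x hx => hc.1 hx.2, fun x hx => hc.1 hx.2⟩
  · rw [Submodule.disjoint_def]
    exact fun x hx hx' => funext fun i =>
      Submodule.disjoint_def.1 h.disjoint _ (hc.1 hx.2 i) (hc.1 hx'.2 i)
  · refine le_antisymm (sup_le inf_le_left inf_le_left) fun x hx => ?_
    have hx' (i : Fin n') : ∃ a ∈ I, ∃ b ∈ J, a + b = x i :=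
      Submodule.mem_sup.1 (h.sup_eq ▸ hk x hx i)
    choose a ha b hb hab using hx'
    have hab' : a + b = x := funext hab
    have hg0 : g a + g b = 0 := by rw [← map_add, hab', hx]
    have hga : g a = 0 := by
      refine Subtype.ext (funext fun i => ?_)
      refine Submodule.disjoint_def.1 h.disjoint _ (hgc (hc.2 ha) i) ?_
      rw [eq_neg_of_add_eq_zero_left hg0]
      exact J.neg_mem (hgc (hc.2 hb) i)
    have hgb : g b = 0 := by rwa [hga, zero_add] at hg0
    exact Submodule.mem_sup.2 ⟨a, ⟨hga, hc.2 ha⟩, b, ⟨hgb, hc.2 hb⟩, hab'⟩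

lemma eq_bot_of_torZero (h : DecomposesMaximalIdeal I J) {n : ℕ}
    {X : Type} [AddCommGroup X] [Module R X] {f : (Fin n → R) →ₗ[R] X} (hf : Surjective f)
    {U V : Submodule R (Fin n → R)} (hd : Disjoint U V) (hUV : U ⊔ V = LinearMap.ker f)
    (hU : ∀ x ∈ U, ∀ i, x i ∈ I) {l : ℕ} (hI : TorZero R I X (l + 1))
    (hJ : TorZero R J X (l + 1)) : U = ⊥ := by
  obtain ⟨hUK, r, hr⟩ := exists_retraction hd hUV
  rw [← Submodule.subsingleton_iff_eq_bot]
  cases l with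
  | zero => exact subsingleton_of_torZero_one h.symm hf hr (fun x => hU x x.2) hJ
  | succ l =>
    by_contra hn
    rw [not_subsingleton_iff_nontrivial] at hn
    rw [torZero_succ_succ_iff hf] at hI hJ
    refine not_torZero_of_smul_eq_zero h U (fun t ht x => Subtype.ext (funext fun i => ?_)) l
      ⟨hI.retract_right hr, hJ.retract_right hr⟩
    exact (mul_comm _ _).trans (h.mul_eq_zero (hU x x.2 i) ht)

lemma pdLE_one_of_torZero_ideals (h : DecomposesMaximalIdeal I J)
    (X : Type) [AddCommGroup X] [Module R X] [Module.Finite R X] {l : ℕ}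
    (hI : TorZero R I X (l + 2)) (hJ : TorZero R J X (l + 2)) : PdLE R X 1 := by
  obtain ⟨n, f, n', g, U, V, hf, hg, hd, hUV, hU, hV⟩ := exists_secondSyzygy h X
  rw [torZero_succ_succ_iff hf] at hI hJ
  refine pdLE_one_of_ker_eq_bot hf hg ?_
  rw [← hUV, eq_bot_of_torZero h hg hd hUV hU hI hJ,
    eq_bot_of_torZero h.symm hg hd.symm (sup_comm U V ▸ hUV) hV hJ hI, sup_bot_eq]

lemma pdLE_one_of_torZero_of_smul_eq_zero (h : DecomposesMaximalIdeal I J)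
    (X Y : Type) [AddCommGroup X] [Module R X] [Module.Finite R X] [Nontrivial X]
    [AddCommGroup Y] [Module R Y] [Module.Finite R Y]
    (hX : ∀ t ∈ J, ∀ x : X, t • x = 0) {l : ℕ}
    (h₁ : TorZero R X Y (l + 3)) (h₂ : TorZero R X Y (l + 4)) : PdLE R Y 1 := by
  obtain ⟨n, f, s, r, hf, hrs, -⟩ := exists_cover_retraction h X hX
  rw [torZero_succ_succ_iff' hf] at h₁ h₂
  have hJ₁ := h₁.retract_left hrs
  have hJ₂ := h₂.retract_left hrs
  have : Nontrivial J := Submodule.nontrivial_iff_ne_bot.2 h.ne_bot_right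
  obtain ⟨n', f', s', r', hf', hrs', -⟩ := exists_cover_retraction h.symm J
    fun t ht x => Subtype.ext (h.mul_eq_zero ht x.2)
  rw [torZero_succ_succ_iff' hf'] at hJ₂
  exact pdLE_one_of_torZero_ideals h Y (hJ₂.retract_left hrs') hJ₁

lemma pdLE_one_or_pdLE_one_of_torZero (h : DecomposesMaximalIdeal I J)
    (X Y : Type) [AddCommGroup X] [Module R X] [Module.Finite R X]
    [AddCommGroup Y] [Module R Y] [Module.Finite R Y] {l : ℕ}
    (h₁ : TorZero R X Y (l + 5)) (h₂ : TorZero R X Y (l + 6)) : PdLE R X 1 ∨ PdLE R Y 1 := by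
  obtain ⟨n, f, n', g, U, V, hf, hg, hd, hUV, hU, hV⟩ := exists_secondSyzygy h X
  rw [torZero_succ_succ_iff' hf, torZero_succ_succ_iff' hg] at h₁ h₂
  by_cases hU₀ : U = ⊥
  · by_cases hV₀ : V = ⊥
    · exact Or.inl (pdLE_one_of_ker_eq_bot hf hg (by rw [← hUV, hU₀, hV₀, sup_bot_eq]))
    · obtain ⟨hVK, r, hr⟩ := exists_retraction hd.symm (sup_comm U V ▸ hUV)
      have : Nontrivial V := Submodule.nontrivial_iff_ne_bot.2 hV₀
      exact Or.inr (pdLE_one_of_torZero_of_smul_eq_zero h.symm V Y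
        (fun t ht x => Subtype.ext (funext fun i => h.mul_eq_zero ht (hV x x.2 i)))
        (h₁.retract_left hr) (h₂.retract_left hr))
  · obtain ⟨hUK, r, hr⟩ := exists_retraction hd hUV
    have : Nontrivial U := Submodule.nontrivial_iff_ne_bot.2 hU₀
    exact Or.inr (pdLE_one_of_torZero_of_smul_eq_zero h U Y
      (fun t ht x => Subtype.ext (funext fun i => h.symm.mul_eq_zero ht (hU x x.2 i)))
      (h₁.retract_left hr) (h₂.retract_left hr))

lemma tfae_torZero_pdLE (h : DecomposesMaximalIdeal I J)
    (X Y : Type) [AddCommGroup X] [Module R X] [Module.Finite R X]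
    [AddCommGroup Y] [Module R Y] [Module.Finite R Y] :
    [ (∃ n : ℕ, ∀ i ≥ n, TorZero R X Y i),
      (∀ i ≥ 2, TorZero R X Y i),
      (∃ i ≥ 5, TorZero R X Y i ∧ TorZero R X Y (i + 1)),
      ((∃ n, PdLE R X n) ∨ (∃ n, PdLE R Y n)),
      (PdLE R X 1 ∨ PdLE R Y 1) ].TFAE := by
  tfae_have 5 → 2
  | .inl hX, i, hi => (hX.torZero Y i hi).2
  | .inr hY, i, hi => (hY.torZero X i hi).1
  tfae_have 2 → 1 := fun h₂ => ⟨2, h₂⟩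
  tfae_have 1 → 3 := fun ⟨n, hn⟩ =>
    ⟨max n 5, le_max_right _ _, hn _ (le_max_left _ _), hn _ (by omega)⟩
  tfae_have 3 → 5 := fun ⟨i, hi, h₁, h₂⟩ => by
    obtain ⟨l, rfl⟩ : ∃ l, i = l + 5 := ⟨i - 5, by omega⟩
    exact pdLE_one_or_pdLE_one_of_torZero h X Y h₁ h₂
  tfae_have 5 → 4 := Or.imp (fun hX => ⟨1, hX⟩) (fun hY => ⟨1, hY⟩)
  tfae_have 4 → 1
  | .inl ⟨n, hX⟩ => ⟨n + 1, fun i hi => (hX.torZero Y i hi).2⟩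
  | .inr ⟨n, hY⟩ => ⟨n + 1, fun i hi => (hY.torZero X i hi).1⟩
  tfae_finish

end Decomposition

section FiberProduct

variable {S T k : Type} [CommRing S] [CommRing T] [Field k] {πS : S →+* k} {πT : T →+* k}

lemma mem_fiberProd {x : S × T} : x ∈ fiberProd πS πT ↔ πS x.1 = πT x.2 := Iff.rfl

/-- The projection of the fiber product to its first factor. -/
def fiberProdFst (πS : S →+* k) (πT : T →+* k) : fiberProd πS πT →+* S :=
  (RingHom.fst S T).comp (fiberProd πS πT).subtype

/-- The projection of the fiber product to its second factor. -/
def fiberProdSnd (πS : S →+* k) (πT : T →+* k) : fiberProd πS πT →+* T :=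
  (RingHom.snd S T).comp (fiberProd πS πT).subtype

lemma fiberProdFst_surjective (hπT : Function.Surjective πT) :
    Function.Surjective (fiberProdFst πS πT) := fun s => by
  obtain ⟨t, ht⟩ := hπT (πS s)
  exact ⟨⟨(s, t), ht.symm⟩, rfl⟩

lemma fiberProdSnd_surjective (hπS : Function.Surjective πS) :
    Function.Surjective (fiberProdSnd πS πT) := fun t => by
  obtain ⟨s, hs⟩ := hπS (πT t)
  exact ⟨⟨(s, t), hs⟩, rfl⟩

lemma isNoetherianRing_fiberProd [IsNoetherianRing S] [IsNoetherianRing T]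
    (hπS : Function.Surjective πS) (hπT : Function.Surjective πT) :
    IsNoetherianRing (fiberProd πS πT) := by
  let := (fiberProdFst πS πT).toModule
  let := (fiberProdSnd πS πT).toModule
  have : RingHomSurjective (fiberProdFst πS πT) := ⟨fiberProdFst_surjective hπT⟩
  have : RingHomSurjective (fiberProdSnd πS πT) := ⟨fiberProdSnd_surjective hπS⟩
  let lS : S →ₛₗ[fiberProdFst πS πT] S :=
    { toFun := id, map_add' := fun _ _ => rfl, map_smul' := fun _ _ => rfl }
  let lT : T →ₛₗ[fiberProdSnd πS πT] T :=
    { toFun := id, map_add' := fun _ _ => rfl, map_smul' := fun _ _ => rfl }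
  have : IsNoetherian (fiberProd πS πT) S :=
    (lS.isNoetherian_iff_of_bijective Function.bijective_id).2 inferInstance
  have : IsNoetherian (fiberProd πS πT) T :=
    (lT.isNoetherian_iff_of_bijective Function.bijective_id).2 inferInstance
  let l : fiberProd πS πT →ₗ[fiberProd πS πT] S × T :=
    { toFun := fun x => (x.1.1, x.1.2)
      map_add' := fun _ _ => rfl
      map_smul' := fun _ _ => rfl }
  exact isNoetherian_of_injective l fun _ _ h => Subtype.ext h

variable [IsLocalRing S] [IsLocalRing T]

lemma isUnit_fiberProd_iff (hkS : RingHom.ker πS = maximalIdeal S)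
    (hkT : RingHom.ker πT = maximalIdeal T) {x : fiberProd πS πT} :
    IsUnit x ↔ πS x.1.1 ≠ 0 := by
  constructor
  · intro hx
    exact ((hx.map (fiberProdFst πS πT)).map πS).ne_zero
  · intro hx
    have hx₁ : IsUnit x.1.1 := by
      rwa [← notMem_maximalIdeal, ← hkS, RingHom.mem_ker]
    have hx₂ : IsUnit x.1.2 := by
      rwa [← notMem_maximalIdeal, ← hkT, RingHom.mem_ker, ← mem_fiberProd.1 x.2]
    obtain ⟨s, hs⟩ := hx₁.exists_right_inv
    obtain ⟨t, ht⟩ := hx₂.exists_right_inv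
    refine .of_mul_eq_one ⟨(s, t), ?_⟩ (Subtype.ext (Prod.ext hs ht))
    refine mem_fiberProd.2 (mul_left_cancel₀ hx ?_)
    rw [← map_mul, hs, mem_fiberProd.1 x.2, ← map_mul, ht, map_one, map_one]

lemma isLocalRing_fiberProd (hkS : RingHom.ker πS = maximalIdeal S)
    (hkT : RingHom.ker πT = maximalIdeal T) : IsLocalRing (fiberProd πS πT) :=
  .of_nonunits_add fun a b ha hb => by
    rw [mem_nonunits_iff, isUnit_fiberProd_iff hkS hkT, not_not] at *
    simp [ha, hb]

lemma decomposesMaximalIdeal_fiberProd [IsLocalRing (fiberProd πS πT)]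
    (hkS : RingHom.ker πS = maximalIdeal S) (hkT : RingHom.ker πT = maximalIdeal T)
    (hS : maximalIdeal S ≠ ⊥) (hT : maximalIdeal T ≠ ⊥) :
    DecomposesMaximalIdeal (RingHom.ker (fiberProdSnd πS πT))
      (RingHom.ker (fiberProdFst πS πT)) where
  disjoint := Submodule.disjoint_def.2 fun x hx hx' => Subtype.ext (Prod.ext hx' hx)
  sup_eq := by
    ext x
    rw [mem_maximalIdeal, mem_nonunits_iff, isUnit_fiberProd_iff hkS hkT, not_not]
    constructor
    · intro hx
      obtain ⟨a, ha, b, hb, rfl⟩ := Submodule.mem_sup.1 hx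
      have ha' : a.1.2 = 0 := ha
      have hb' : b.1.1 = 0 := hb
      simp [mem_fiberProd.1 a.2, ha', hb']
    · intro hx
      have hx' : πT x.1.2 = 0 := by rw [← mem_fiberProd.1 x.2, hx]
      refine Submodule.mem_sup.2 ⟨⟨(x.1.1, 0), mem_fiberProd.2 (by simp [hx])⟩, rfl,
        ⟨(0, x.1.2), mem_fiberProd.2 (by simp [hx'])⟩, rfl, Subtype.ext ?_⟩
      exact Prod.ext (add_zero _) (zero_add _)
  ne_bot_left := by
    obtain ⟨s, hs, hs₀⟩ := Submodule.exists_mem_ne_zero_of_ne_bot hS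
    rw [← hkS, RingHom.mem_ker] at hs
    refine (Submodule.ne_bot_iff _).2 ⟨⟨(s, 0), mem_fiberProd.2 (by simp [hs])⟩, rfl, ?_⟩
    exact fun h => hs₀ (congrArg (fun x => x.1.1) h)
  ne_bot_right := by
    obtain ⟨t, ht, ht₀⟩ := Submodule.exists_mem_ne_zero_of_ne_bot hT
    rw [← hkT, RingHom.mem_ker] at ht
    refine (Submodule.ne_bot_iff _).2 ⟨⟨(0, t), mem_fiberProd.2 (by simp [ht])⟩, rfl, ?_⟩
    exact fun h => ht₀ (congrArg (fun x => x.1.2) h)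

end FiberProduct

/-- Theorem 2.12: over a fiber product `R = S ×ₖ T`, the five
Tor-vanishing/projective-dimension conditions are equivalent. -/
theorem stmt_1 (S T k : Type) [CommRing S] [CommRing T] [Field k]
    [IsNoetherianRing S] [IsNoetherianRing T] [IsLocalRing S] [IsLocalRing T]
    (πS : S →+* k) (πT : T →+* k)
    (hπS : Function.Surjective πS) (hπT : Function.Surjective πT)
    (hkS : RingHom.ker πS = maximalIdeal S) (hkT : RingHom.ker πT = maximalIdeal T)
    (hS : maximalIdeal S ≠ ⊥) (hT : maximalIdeal T ≠ ⊥)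
    (M N : Type) [AddCommGroup M] [Module (fiberProd πS πT) M]
    [Module.Finite (fiberProd πS πT) M]
    [AddCommGroup N] [Module (fiberProd πS πT) N]
    [Module.Finite (fiberProd πS πT) N] :
    [ (∃ n : ℕ, ∀ i ≥ n, TorZero (fiberProd πS πT) M N i),
      (∀ i ≥ 2, TorZero (fiberProd πS πT) M N i),
      (∃ i ≥ 5, TorZero (fiberProd πS πT) M N i ∧ TorZero (fiberProd πS πT) M N (i + 1)),
      ((∃ n, PdLE (fiberProd πS πT) M n) ∨ (∃ n, PdLE (fiberProd πS πT) N n)),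
      (PdLE (fiberProd πS πT) M 1 ∨ PdLE (fiberProd πS πT) N 1) ].TFAE := by
  have := isNoetherianRing_fiberProd hπS hπT
  have := isLocalRing_fiberProd hkS hkT
  exact tfae_torZero_pdLE (decomposesMaximalIdeal_fiberProd hkS hkT hS hT) M N
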